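/- For any prime p ≥ 5 and any positive integer r, ∑_{k=0}^{p^r−1} (4k+1) · (1/2)_k^4 / (1)_k^4 ≡ p^r (mod p^{r+3}). -/

import Mathlib

noncomputable section

/-- Pochhammer symbol `(x)_n = x(x+1)⋯(x+n-1)`. -/
def poch (x : ℚ) (n : ℕ) : ℚ := ∏ i ∈ Finset.range n, (x + i)

/-- `n`-th harmonic number of order 2: `H_n^{(2)} = ∑_{k=1}^n 1/k^2`. -/
def H2 (n : ℕ) : ℚ := ∑ k ∈ Finset.Icc 1 n, (1 : ℚ) / (k : ℚ) ^ 2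

/-- Least nonnegative residue of a rational `x` (with denominator coprime to `m`)
modulo `m`: the unique integer in `{0, …, m-1}` congruent to `x` mod `m`. -/
def res (m : ℕ) (x : ℚ) : ℕ := ((x.num : ZMod m) * (x.den : ZMod m)⁻¹).val

/-- Dwork's dash operation: `x* = (x + ⟨-x⟩_p)/p`. -/
def dash (p : ℕ) (x : ℚ) : ℚ := (x + (res p (-x) : ℚ)) / p

/-- `r`-fold iterate of Dwork's dash operation, with `x^{*_0} = x`. -/
def dashIter (p r : ℕ) (x : ℚ) : ℚ := (dash p)^[r] x

/-- For rationals `u, v`, `u ≡ v (mod p^m)` means `u = v` or the `p`-adic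
valuation of `u - v` is at least `m`. -/
def ratCongr (p : ℕ) (m : ℤ) (u v : ℚ) : Prop :=
  u = v ∨ m ≤ padicValRat p (u - v)

lemma poch_succ (x : ℚ) (n : ℕ) : poch x (n+1) = poch x n * (x + n) := by
  simp [poch, Finset.prod_range_succ]

lemma poch_succ_left (x : ℚ) (n : ℕ) : poch x (n+1) = x * poch (x+1) n := by
  unfold poch
  rw [Finset.prod_range_succ', mul_comm]
  congr 1
  · simp
  · apply Finset.prod_congr rfl
    intro i _
    push_cast; ring

lemma poch_zero (x : ℚ) : poch x 0 = 1 := by simp [poch]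

lemma poch_ne (x : ℚ) (n : ℕ) (h : ∀ i : ℕ, x + i ≠ 0) : poch x n ≠ 0 :=
  Finset.prod_ne_zero_iff.mpr fun i _ => h i

lemma poch_one (n : ℕ) : poch 1 n = (n.factorial : ℚ) := by
  induction n with
  | zero => simp [poch]
  | succ n ih => rw [poch_succ, ih, Nat.factorial_succ]; push_cast; ring

lemma poch_one_ne (n : ℕ) : poch 1 n ≠ 0 := by
  rw [poch_one]; exact_mod_cast n.factorial_ne_zero

lemma poch_neg_self (n : ℕ) : poch (-(n:ℚ)) (n+1) = 0 := by
  rw [poch_succ]; simp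

def DD (z : ℚ) (n : ℕ) : ℚ := ∏ i ∈ Finset.range n, (((i:ℚ)+1)^2 - z)
def EE (z : ℚ) (n : ℕ) : ℚ := ∏ i ∈ Finset.range n, (((i:ℚ)+1/2)^2 - z)

lemma DD_succ (z : ℚ) (n : ℕ) : DD z (n+1) = DD z n * (((n:ℚ)+1)^2 - z) := by
  simp [DD, Finset.prod_range_succ]
lemma EE_succ (z : ℚ) (n : ℕ) : EE z (n+1) = EE z n * (((n:ℚ)+1/2)^2 - z) := by
  simp [EE, Finset.prod_range_succ]

lemma DD_ne (z : ℚ) (n : ℕ) (hz : ∀ i : ℕ, ((i:ℚ)+1)^2 - z ≠ 0) : DD z n ≠ 0 :=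
  Finset.prod_ne_zero_iff.mpr fun i _ => hz i

def vv (z n : ℚ) (j : ℕ) : ℚ :=
  poch (1/2) j * poch (n+1/2) j * poch (-n) j / (poch 1 j * DD z j)

lemma cert1 (z n : ℚ) (hz : ∀ i : ℕ, ((i:ℚ)+1)^2 - z ≠ 0) (J : ℕ) :
    ∑ j ∈ Finset.range (J+1), (((n+1)^2 - z) * vv z (n+1) j - ((n+1/2)^2 - z) * vv z n j)
      = (2*J+1)*(4*n+3)/4 * poch (1/2) J * poch (n+3/2) J * poch (-n) J / (poch 1 J * DD z J) := by
  induction J with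
  | zero => simp [vv, poch, DD]; ring
  | succ J ih =>
    rw [Finset.sum_range_succ, ih]
    have h1 : poch (n+1+1/2) (J+1) = poch (n+3/2) J * (n+3/2+J) := by
      rw [show n+1+1/2 = n+3/2 by ring, poch_succ]
    have h2 : poch (-(n+1)) (J+1) = -(n+1) * poch (-n) J := by
      rw [poch_succ_left, show -(n+1)+1 = -n by ring]
    have h3 : poch (n+1/2) (J+1) = (n+1/2) * poch (n+3/2) J := by
      rw [poch_succ_left, show n+1/2+1 = n+3/2 by ring]
    have d1 := poch_one_ne J
    have d2 := DD_ne z J hz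
    have d3 := hz J
    have d4 : (1:ℚ) + J ≠ 0 := by positivity
    unfold vv
    rw [h1, h2, h3, poch_succ (1/2), poch_succ 1, DD_succ, poch_succ (-n), poch_succ (n+3/2)]
    generalize poch (1/2) J = A at *
    generalize poch (n+3/2) J = B at *
    generalize poch (-n) J = C at *
    generalize poch 1 J = P at *
    generalize DD z J = Q at *
    push_cast
    field_simp
    ring

lemma saal (z : ℚ) (hz : ∀ i : ℕ, ((i:ℚ)+1)^2 - z ≠ 0) (n : ℕ) :
    ∑ j ∈ Finset.range (n+1), vv z n j = EE z n / DD z n := by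
  induction n with
  | zero => simp [vv, poch, DD, EE]
  | succ n ih =>
    have h := cert1 z n hz (n+1)
    rw [poch_neg_self, Finset.sum_sub_distrib, ← Finset.mul_sum, ← Finset.mul_sum,
      Finset.sum_range_succ (fun j => vv z n j), ih] at h
    have h0 : vv z n (n+1) = 0 := by simp [vv, poch_neg_self]
    rw [h0] at h
    simp only [mul_zero, zero_div, add_zero] at h
    rw [EE_succ, DD_succ]
    have d2 := DD_ne z n hz
    have d3 := hz n
    push_cast at h ⊢
    generalize ∑ k ∈ Finset.range (n+1+1), vv z (n+1) k = X at *
    rw [eq_div_iff (by simp [d2,d3])]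
    have h' : ((n+1)^2-z) * X = ((n+1/2)^2-z) * (EE z n / DD z n) := by linarith
    have h4 : EE z n / DD z n * DD z n = EE z n := by field_simp
    linear_combination DD z n * h' + ((n+1/2)^2-z) * h4

def uu (z n : ℚ) (j : ℕ) : ℚ :=
  poch (1/2) j * poch (n+1/2) j * poch (1-n) j / (poch 1 j * DD z j * (2*j+1))

def aa (n : ℕ) : ℚ := poch (1/2) n / poch 1 n

lemma aa_succ (n : ℕ) : aa (n+1) * (2 * (n+1)) = aa n * (2*n+1) := by
  unfold aa
  rw [poch_succ, poch_succ]
  have d1 := poch_one_ne n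
  have d4 : (1:ℚ) + n ≠ 0 := by positivity
  field_simp
  ring

lemma uu_step (z n : ℚ) (hz : ∀ i : ℕ, ((i:ℚ)+1)^2 - z ≠ 0) (j : ℕ) :
    (2*n+1)^2 * uu z (n+1) j - 4*n^2 * uu z n j = (4*n+1) * vv z n j := by
  have h1 : n * poch (1-n) j = poch (-n) j * (n-j) := by
    have := poch_succ_left (-n) j
    rw [poch_succ, show -n+1 = 1-n by ring] at this
    linear_combination this
  have h2 : (n+1/2) * poch (n+1+1/2) j = poch (n+1/2) j * (n+1/2+j) := by
    have := poch_succ_left (n+1/2) j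
    rw [poch_succ, show n+1/2+1 = n+1+1/2 by ring] at this
    linear_combination -this
  have d1 := poch_one_ne j
  have d2 := DD_ne z j hz
  have d4 : (2:ℚ)*j+1 ≠ 0 := by positivity
  unfold uu vv
  rw [show 1-(n+1) = -n by ring]
  generalize poch (1/2) j = A at *
  generalize poch (n+1+1/2) j = B at *
  generalize poch (n+1/2) j = B' at *
  generalize poch (1-n) j = C' at *
  generalize poch (-n) j = C at *
  have e : (2*n+1)^2 * (A*B*C) - 4*n^2*(A*B'*C') = (4*n+1)*(A*B'*C)*(2*j+1) := by
    linear_combination (4*n+2)*A*C*h2 - 4*n*A*B'*h1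
  rw [mul_div_assoc', mul_div_assoc', ← sub_div, e]
  field_simp

lemma trunc (z : ℚ) (hz : ∀ i : ℕ, ((i:ℚ)+1)^2 - z ≠ 0) (n : ℕ) :
    4*(n:ℚ)^2 * aa n^2 * ∑ j ∈ Finset.range n, uu z n j
      = ∑ k ∈ Finset.range n, (4*(k:ℚ)+1) * aa k^2 * (EE z k / DD z k) := by
  induction n with
  | zero => simp
  | succ n ih =>
    rw [Finset.sum_range_succ (fun k : ℕ => (4*(k:ℚ)+1) * aa k^2 * (EE z k / DD z k)), ← ih,
      ← saal z hz n]
    have h0 : 4*(n:ℚ)^2 * uu z n n = 0 := by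
      rcases n with _ | n
      · simp
      · have : poch (1-((n+1:ℕ):ℚ)) (n+1) = 0 := by
          rw [show (1-((n+1:ℕ):ℚ)) = -(n:ℚ) by push_cast; ring, poch_neg_self]
        unfold uu
        rw [this]; simp
    have h1 : (2*(n:ℚ)+1)^2 * ∑ j ∈ Finset.range (n+1), uu z (n+1) j
        - 4*n^2 * ∑ j ∈ Finset.range (n+1), uu z n j
        = (4*n+1) * ∑ j ∈ Finset.range (n+1), vv z n j := by
      rw [Finset.mul_sum, Finset.mul_sum, Finset.mul_sum, ← Finset.sum_sub_distrib]
      exact Finset.sum_congr rfl fun j _ => uu_step z n hz j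
    rw [Finset.sum_range_succ (fun j => uu z n j)] at h1
    have h2 := aa_succ n
    push_cast
    generalize ∑ j ∈ Finset.range (n+1), uu z (n+1) j = X at *
    have h3 : 4*((n:ℚ)+1)^2 * aa (n+1)^2 = (2*n+1)^2 * aa n^2 := by
      linear_combination (aa (n+1) * (2 * (n+1)) + aa n * (2*n+1)) * h2
    rw [h3]
    linear_combination (aa n)^2 * h1 + (aa n)^2 * h0

def ff (m c : ℚ) (k : ℕ) : ℚ :=
  (4*(k:ℚ)+1) * aa k^2 * (poch (-m) k * poch c k / (poch (3/2+m) k * poch (3/2-c) k))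

lemma cert2 (m c : ℚ) (hm : ∀ i : ℕ, 3/2+m+i ≠ 0) (hc : ∀ i : ℕ, 3/2-c+i ≠ 0) (J : ℕ) :
    ∑ k ∈ Finset.range (J+1), ((3/2-c+m)*(m+1) * ff (m+1) c k - (3/2+m)*(1-c+m)*ff m c k)
      = 2 * poch (1/2) (J+1)^2 * poch c (J+1) * poch (-m) J /
        (poch 1 J^2 * poch (5/2+m) J * poch (3/2-c) J) := by
  have hm' : ∀ i : ℕ, 5/2+m+i ≠ 0 := fun i => by
    have := hm (i+1); push_cast at this; intro h; apply this; linarith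
  induction J with
  | zero => simp [ff, poch, aa]; ring
  | succ J ih =>
    rw [Finset.sum_range_succ, ih]
    have h1 : poch (3/2+(m+1)) (J+1) = poch (5/2+m) J * (5/2+m+J) := by
      rw [show 3/2+(m+1) = 5/2+m by ring, poch_succ]
    have h2 : poch (-(m+1)) (J+1) = -(m+1) * poch (-m) J := by
      rw [poch_succ_left, show -(m+1)+1 = -m by ring]
    have h3 : poch (3/2+m) (J+1) = (3/2+m) * poch (5/2+m) J := by
      rw [poch_succ_left, show 3/2+m+1 = 5/2+m by ring]
    have d1 := poch_one_ne J
    have d2 := poch_ne _ J hm'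
    have d3 := poch_ne _ J hc
    have d4 : (1:ℚ) + J ≠ 0 := by positivity
    have d5 := hm' J
    have d6 := hc J
    have d7 : 3/2+m ≠ 0 := by simpa using hm 0
    unfold ff aa
    rw [h1, h2, h3, poch_succ c (J+1), poch_succ (1/2) (J+1), poch_succ 1,
      poch_succ (-m), poch_succ (5/2+m), poch_succ (3/2-c), poch_succ (1/2), poch_succ c]
    generalize poch (1/2) J = A at *
    generalize poch (5/2+m) J = B at *
    generalize poch (-m) J = C at *
    generalize poch 1 J = P at *
    generalize poch c J = Q at *
    generalize poch (3/2-c) J = R at *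
    generalize hw1 : 3/2+m = w1 at *
    generalize hw2 : 3/2-c+J = w2 at *
    generalize hw3 : 5/2+m+J = w3 at *
    obtain rfl : m = w1 - 3/2 := by linarith
    obtain rfl : w3 = w1 + 1 + J := by linarith
    obtain rfl : c = 3/2+J-w2 := by linarith
    push_cast
    field_simp
    ring

lemma dougall (c : ℚ) (hc : ∀ i : ℕ, 3/2-c+i ≠ 0) (m : ℕ) :
    ∑ k ∈ Finset.range (m+1), ff m c k
      = poch (3/2) m * poch (1-c) m / (poch (3/2-c) m * poch 1 m) := by
  induction m with
  | zero => simp [ff, poch, aa]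
  | succ m ih =>
    have h := cert2 m c (fun i => by positivity) hc (m+1)
    rw [poch_neg_self, Finset.sum_sub_distrib, ← Finset.mul_sum, ← Finset.mul_sum,
      Finset.sum_range_succ (fun j => ff m c j), ih] at h
    have h0 : ff m c (m+1) = 0 := by simp [ff, poch_neg_self]
    rw [h0] at h
    simp only [mul_zero, zero_div, add_zero] at h
    have d1 := poch_one_ne m
    have d2 := poch_ne _ m hc
    have d3 := hc m
    have d4 : (1:ℚ) + m ≠ 0 := by positivity
    rw [poch_succ, poch_succ, poch_succ, poch_succ]
    push_cast at h ⊢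
    generalize ∑ k ∈ Finset.range (m+1+1), ff (m+1) c k = X at *
    rw [eq_div_iff (by simp [d1,d2,d3,d4])]
    generalize poch (3/2-c) m = R at *
    have h4 : poch (3/2) m * poch (1-c) m / (R * poch 1 m) * (R * poch 1 m)
      = poch (3/2) m * poch (1-c) m := by field_simp
    linear_combination (R * poch 1 m) * h + (3/2+m)*(1-c+m) * h4

lemma EE_eq (m k : ℕ) : EE ((m+1/2)^2) k = poch (-(m:ℚ)) k * poch (m+1) k := by
  unfold EE poch
  rw [← Finset.prod_mul_distrib]
  exact Finset.prod_congr rfl fun i _ => by ring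

lemma DD_eq (m k : ℕ) : DD ((m+1/2)^2) k = poch (3/2+(m:ℚ)) k * poch (3/2-(m+1)) k := by
  unfold DD poch
  rw [← Finset.prod_mul_distrib]
  exact Finset.prod_congr rfl fun i _ => by ring

lemma half_ne (a b : ℤ) : (a:ℚ) + 1/2 - b ≠ 0 := by
  intro h
  have : ((2*a+1-2*b : ℤ):ℚ) = 0 := by push_cast; linarith
  have : 2*a+1-2*b = 0 := by exact_mod_cast this
  omega

lemma poch_half_neg (m : ℕ) : poch (3/2-((m:ℚ)+1)) m = (-1)^m * poch (1/2) m := by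
  unfold poch
  have e : ((-1:ℚ))^m = ∏ i ∈ Finset.range m, (-1:ℚ) := by simp
  rw [← Finset.prod_range_reflect, e, ← Finset.prod_mul_distrib]
  refine Finset.prod_congr rfl fun i hi => ?_
  have : i + 1 ≤ m := Finset.mem_range.mp hi
  rw [show m - 1 - i = m - (i+1) by omega, Nat.cast_sub this]
  push_cast; ring

lemma poch_int_neg (m : ℕ) : poch (1-((m:ℚ)+1)) m = (-1)^m * poch 1 m := by
  unfold poch
  have e : ((-1:ℚ))^m = ∏ i ∈ Finset.range m, (-1:ℚ) := by simp
  rw [← Finset.prod_range_reflect, e, ← Finset.prod_mul_distrib]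
  refine Finset.prod_congr rfl fun i hi => ?_
  have : i + 1 ≤ m := Finset.mem_range.mp hi
  rw [show m - 1 - i = m - (i+1) by omega, Nat.cast_sub this]
  push_cast; ring

lemma hz_half (m : ℕ) (i : ℕ) : ((i:ℚ)+1)^2 - ((m:ℚ)+1/2)^2 ≠ 0 := by
  have h1 := half_ne m (i+1)
  have h2 : (i:ℚ)+1 + (m+1/2) ≠ 0 := by positivity
  push_cast at h1
  intro h
  have : ((m:ℚ)+1/2-(i+1)) * ((i:ℚ)+1 + (m+1/2)) = 0 := by linarith
  rcases mul_eq_zero.mp this with h | h <;> contradiction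

lemma dougall' (m : ℕ) :
    ∑ k ∈ Finset.range (2*m+1), (4*(k:ℚ)+1) * aa k^2 *
      (EE ((m+1/2)^2) k / DD ((m+1/2)^2) k) = 2*(m:ℚ)+1 := by
  have hc : ∀ i : ℕ, 3/2-((m:ℚ)+1)+i ≠ 0 := fun i => by
    have := half_ne i m; push_cast at this; intro h; apply this; linarith
  have h := dougall (m+1) hc m
  rw [poch_half_neg, poch_int_neg] at h
  have e : ∀ k : ℕ, (4*(k:ℚ)+1) * aa k^2 *
      (EE ((m+1/2)^2) k / DD ((m+1/2)^2) k) = ff m (m+1) k := fun k => by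
    rw [EE_eq, DD_eq]; rfl
  simp_rw [e]
  have e2 : ∑ k ∈ Finset.range (2*m+1), ff m (m+1) k = ∑ k ∈ Finset.range (m+1), ff m (m+1) k := by
    symm
    apply Finset.sum_subset
    · intro k; simp; omega
    · intro k _ hk
      have hk : m < k := by simpa using hk
      have : poch (-(m:ℚ)) k = 0 := Finset.prod_eq_zero (Finset.mem_range.mpr hk) (by simp)
      simp [ff, this]
  rw [e2, h]
  have h3 := poch_succ_left (1/2) m
  rw [poch_succ, show (1/2+1:ℚ) = 3/2 by norm_num] at h3
  have d1 := poch_one_ne m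
  have d2 := poch_ne (1/2) m (fun i => by positivity)
  have d3 : (-1:ℚ)^m ≠ 0 := by positivity
  field_simp
  linear_combination -2*h3

/-- The key exact identity. -/
lemma key (m n : ℕ) (hn : n = 2*m+1) :
    ∑ k ∈ Finset.range n, (4*(k:ℚ)+1) * poch (1/2) k^4 / poch 1 k^4 - (n:ℚ)
      = ∑ j ∈ Finset.range n, 4*(n:ℚ)^2 * aa n^2 * (uu 0 n j - uu ((m+1/2)^2) n j) := by
  have h0 : ∀ i : ℕ, ((i:ℚ)+1)^2 - 0 ≠ 0 := fun i => by
    have : (i:ℚ)+1 ≠ 0 := by positivity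
    simpa using this
  have t0 := trunc 0 h0 n
  have t1 := trunc _ (hz_half m) n
  have d := dougall' m
  rw [← hn] at d
  rw [d] at t1
  rw [← Finset.mul_sum, Finset.sum_sub_distrib, mul_sub, t0, t1]
  congr 1
  · refine Finset.sum_congr rfl fun k _ => ?_
    have e1 : EE 0 k = poch (1/2) k^2 := by
      unfold EE poch; rw [← Finset.prod_pow]
      exact Finset.prod_congr rfl fun i _ => by ring
    have e2 : DD 0 k = poch 1 k^2 := by
      unfold DD poch; rw [← Finset.prod_pow]
      exact Finset.prod_congr rfl fun i _ => by ring
    have d1 := poch_one_ne k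
    rw [e1, e2, aa]
    field_simp
  · rw [hn]; push_cast; ring

section padic
variable (p : ℕ) [hp : Fact p.Prime]

def PP (x : ℤ) (a : ℚ) : Prop := padicNorm p a ≤ (p:ℚ)^x

lemma p_pos : (0:ℚ) < p := by exact_mod_cast hp.out.pos
lemma p_one : (1:ℚ) ≤ p := by exact_mod_cast hp.out.one_lt.le

variable {p}
set_option linter.unusedSectionVars false
lemma PP.congr {x y : ℤ} {a b : ℚ} (h : PP p x a) (hxy : x = y) (hab : a = b) : PP p y b := by
  subst hxy hab; exact h

lemma PP.mono {x y : ℤ} {a : ℚ} (h : PP p x a) (hxy : x ≤ y) : PP p y a :=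
  le_trans h (zpow_le_zpow_right₀ (p_one p) hxy)

lemma PP.mul {x y : ℤ} {a b : ℚ} (ha : PP p x a) (hb : PP p y b) : PP p (x+y) (a*b) := by
  unfold PP at *
  rw [padicNorm.mul, zpow_add₀ (p_pos p).ne']
  exact mul_le_mul ha hb (padicNorm.nonneg _) (zpow_nonneg (p_pos p).le _)

lemma PP.add {x : ℤ} {a b : ℚ} (ha : PP p x a) (hb : PP p x b) : PP p x (a+b) :=
  le_trans padicNorm.nonarchimedean (max_le ha hb)

lemma PP.neg {x : ℤ} {a : ℚ} (ha : PP p x a) : PP p x (-a) := by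
  unfold PP; rw [padicNorm.neg]; exact ha

lemma PP.zero (x : ℤ) : PP p x 0 := by
  unfold PP; rw [padicNorm.zero]; exact zpow_nonneg (p_pos p).le _

lemma PP.sum {ι : Type} {x : ℤ} (s : Finset ι) (f : ι → ℚ) (h : ∀ i ∈ s, PP p x (f i)) :
    PP p x (∑ i ∈ s, f i) := by
  classical
  induction s using Finset.induction_on with
  | empty => simpa using PP.zero x
  | insert a s ha ih =>
    rw [Finset.sum_insert ha]
    exact (h a (by simp)).add (ih fun i hi => h i (by simp [hi]))

lemma PP.nat (a : ℕ) : PP p 0 a := by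
  unfold PP; simpa using padicNorm.of_nat (p := p) a

lemma PP.neg_one_pow (a : ℕ) : PP p 0 ((-1)^a) := by
  rcases neg_one_pow_eq_or ℚ a with h | h <;> rw [h]
  · simpa using PP.nat (p := p) 1
  · simpa using (PP.nat (p := p) 1).neg

lemma PP.ppow (s : ℕ) : PP p (-s) ((p:ℚ)^s) := by
  have h : padicNorm p (p:ℚ) = (p:ℚ)⁻¹ := padicNorm.padicNorm_p_of_prime
  unfold PP
  have : padicNorm p ((p:ℚ)^s) = (padicNorm p (p:ℚ))^s := by
    induction s with
    | zero => simp
    | succ s ih => rw [pow_succ, padicNorm.mul, ih, pow_succ]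
  rw [this, h]; simp

lemma PP.inv_nat (a t : ℕ) (h0 : a ≠ 0) (h : ¬ p^(t+1) ∣ a) : PP p t ((a:ℚ)⁻¹) := by
  unfold PP
  have h1 : padicValNat p a ≤ t := by
    by_contra hc
    exact h ((padicValNat_dvd_iff_le h0).mpr (by omega))
  have : padicNorm p ((a:ℚ)⁻¹) = (p:ℚ)^(padicValNat p a : ℤ) := by
    rw [padicNorm.eq_zpow_of_nonzero (by simpa using h0)]
    rw [padicValRat.inv]
    simp
  rw [this]
  exact zpow_le_zpow_right₀ (p_one p) (by exact_mod_cast h1)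

lemma PP.inv_unit (a : ℕ) (h : ¬ p ∣ a) : PP p 0 ((a:ℚ)⁻¹) := by
  have h0 : a ≠ 0 := by rintro rfl; simp at h
  simpa using PP.inv_nat a 0 h0 (by simpa using h)

lemma ratCongr_of_PP (x : ℤ) (a b : ℚ) (h : PP p (-x) (a-b)) : ratCongr p x a b := by
  by_cases hab : a = b
  · exact Or.inl hab
  · right
    have h0 : a - b ≠ 0 := sub_ne_zero.mpr hab
    unfold PP at h
    rw [padicNorm.eq_zpow_of_nonzero h0] at h
    have := (zpow_le_zpow_iff_right₀ (by exact_mod_cast hp.out.one_lt : (1:ℚ) < p)).mp h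
    omega

lemma prod_bound (x : ℤ) (hx : x ≤ 0) (e : ℕ → ℚ) (j : ℕ) (he : ∀ i < j, PP p x (e i)) :
    PP p x (∏ i ∈ Finset.range j, (1 - e i) - 1) ∧
    PP p (x+x) (∏ i ∈ Finset.range j, (1 - e i) - 1 + ∑ i ∈ Finset.range j, e i) := by
  induction j with
  | zero => simp [PP.zero]
  | succ j ih =>
    obtain ⟨h1, h2⟩ := ih fun i hi => he i (by omega)
    have hj := he j (by omega)
    rw [Finset.prod_range_succ, Finset.sum_range_succ]
    generalize ∏ i ∈ Finset.range j, (1 - e i) = A at *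
    have h3 := (hj.mul h1).neg
    constructor
    · exact ((h1.add (h3.mono (by omega))).add hj.neg).congr rfl (by ring)
    · exact (h2.add h3).congr rfl (by ring)

lemma inv_bound (a : ℚ) (h : PP p (-1) (a-1)) : PP p 0 (a⁻¹) := by
  have h1 : padicNorm p 1 ≤ max (padicNorm p a) (padicNorm p (-(a-1))) := by
    have := padicNorm.nonarchimedean (p := p) (q := a) (r := -(a-1))
    simpa using this
  have h2 : (p:ℚ)^(-1:ℤ) < 1 := by
    rw [zpow_neg_one]; exact inv_lt_one_of_one_lt₀ (by exact_mod_cast hp.out.one_lt)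
  have h3 := lt_of_le_of_lt h.neg h2
  rw [padicNorm.one, le_max_iff] at h1
  have h4 : 1 ≤ padicNorm p a := by
    rcases h1 with h1 | h1
    · exact h1
    · exact absurd h1 (not_le.mpr h3)
  unfold PP
  have h5 : padicNorm p a * padicNorm p a⁻¹ = 1 := by
    rw [← padicNorm.mul, mul_inv_cancel₀, padicNorm.one]
    rintro rfl; rw [padicNorm.zero] at h4; linarith
  have h6 := padicNorm.nonneg (p := p) a⁻¹
  simp only [zpow_zero]
  nlinarith

lemma harm (hp5 : 5 ≤ p) :
    PP p (-1) (∑ k ∈ Finset.Icc 1 ((p-1)/2), ((k:ℚ)^2)⁻¹) := by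
  set h := (p-1)/2 with hh
  have hodd : p % 2 = 1 := by
    rcases hp.out.eq_two_or_odd with h | h <;> omega
  have hp2 : p = 2*h+1 := by omega
  -- the sum in ZMod p
  have z1 : ∑ x : ZMod p, (x^(p-3)) = 0 := by
    apply FiniteField.sum_pow_lt_card_sub_one
    rw [ZMod.card]; omega
  have z2 : ∑ x : ZMod p, (x^(p-3)) = ∑ k ∈ Finset.range p, ((k:ZMod p)^(p-3)) := by
    symm
    apply Finset.sum_bij (fun (k : ℕ) _ => (k : ZMod p))
    · simp
    · intro a ha b hb hab
      rw [ZMod.natCast_eq_natCast_iff'] at hab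
      rwa [Nat.mod_eq_of_lt (Finset.mem_range.mp ha), Nat.mod_eq_of_lt (Finset.mem_range.mp hb)] at hab
    · intro b _
      exact ⟨b.val, Finset.mem_range.mpr (ZMod.val_lt b), by simp⟩
    · simp
  have z3 : ∑ k ∈ Finset.range p, ((k:ZMod p)^(p-3)) =
      2 * ∑ k ∈ Finset.Icc 1 h, ((k:ZMod p)^(p-3)) := by
    have e1 : Finset.Icc 1 h = Finset.Ico 1 (h+1) := by ext; simp only [Finset.mem_Icc, Finset.mem_Ico]; omega
    rw [e1, Finset.range_eq_Ico, Finset.sum_eq_sum_Ico_succ_bot (by omega),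
      ← Finset.sum_Ico_consecutive _ (show 0+1 ≤ h+1 by omega) (show h+1 ≤ p by omega)]
    have e2 : ∑ k ∈ Finset.Ico (h+1) p, ((k:ZMod p)^(p-3)) =
        ∑ k ∈ Finset.Ico 1 (h+1), ((k:ZMod p)^(p-3)) := by
      apply Finset.sum_bij' (fun k _ => p - k) (fun k _ => p - k)
      · intro a ha; simp at ha ⊢; omega
      · intro a ha; simp at ha ⊢; omega
      · intro a ha; simp at ha ⊢; omega
      · intro a ha; simp at ha ⊢; omega
      · intro a ha
        simp at ha
        rw [Nat.cast_sub (by omega)]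
        have : Even (p-3) := by rw [Nat.even_iff]; omega
        simp [this.neg_pow]
    rw [e2]
    simp only [Nat.cast_zero]
    rw [zero_pow (by omega)]
    ring
  have z4 : ∑ k ∈ Finset.Icc 1 h, ((k:ZMod p)^(p-3)) = 0 := by
    have : (2:ZMod p) ≠ 0 := by
      intro h2
      have : ((2:ℕ):ZMod p) = 0 := by exact_mod_cast h2
      rw [ZMod.natCast_eq_zero_iff] at this
      have := Nat.le_of_dvd (by norm_num) this
      omega
    rw [z1] at z2
    rw [← z2] at z3
    rcases mul_eq_zero.mp z3.symm with h | h
    · contradiction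
    · exact h
  have hdvd : p ∣ ∑ k ∈ Finset.Icc 1 h, (h.factorial / k)^2 := by
    rw [← ZMod.natCast_eq_zero_iff, Nat.cast_sum]
    have : ∀ k ∈ Finset.Icc 1 h, (((h.factorial / k)^2 : ℕ) : ZMod p) =
        (h.factorial : ZMod p)^2 * (k:ZMod p)^(p-3) := by
      intro k hk
      simp at hk
      have hk0 : (k:ZMod p) ≠ 0 := by
        rw [Ne, ZMod.natCast_eq_zero_iff]
        intro hd
        have := Nat.le_of_dvd (by omega) hd
        omega
      have e1 : ((h.factorial / k : ℕ) : ZMod p) * k = h.factorial := by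
        rw [← Nat.cast_mul, Nat.div_mul_cancel (Nat.dvd_factorial (by omega) hk.2)]
      have e2 : (k:ZMod p)^(p-3) * k^2 = 1 := by
        rw [← pow_add, show p-3+2 = p-1 by omega]
        exact ZMod.pow_card_sub_one_eq_one hk0
      push_cast
      rw [← e1]
      linear_combination -(((h.factorial / k : ℕ) : ZMod p))^2 * e2
    rw [Finset.sum_congr rfl this, ← Finset.mul_sum, z4, mul_zero]
  have hf : ¬ p ∣ h.factorial := by
    rw [hp.out.dvd_factorial]; omega
  obtain ⟨w, hw⟩ := hdvd
  have e : ∑ k ∈ Finset.Icc 1 h, ((k:ℚ)^2)⁻¹ =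
      (p:ℚ)^1 * w * ((h.factorial:ℚ)⁻¹ * (h.factorial:ℚ)⁻¹) := by
    have hw' : (∑ k ∈ Finset.Icc 1 h, ((h.factorial / k : ℕ):ℚ)^2) = p * w := by exact_mod_cast hw
    have f0 : (h.factorial : ℚ) ≠ 0 := by exact_mod_cast h.factorial_ne_zero
    rw [pow_one, ← hw', Finset.sum_mul]
    refine Finset.sum_congr rfl fun k hk => ?_
    simp at hk
    have k0 : (k:ℚ) ≠ 0 := by
      have : k ≠ 0 := by omega
      exact_mod_cast this
    rw [Nat.cast_div (Nat.dvd_factorial (by omega) hk.2) k0]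
    field_simp
  rw [e]
  exact (((PP.ppow 1).mul (PP.nat w)).mul
    ((PP.inv_unit _ hf).mul (PP.inv_unit _ hf))).congr (by norm_num) rfl

lemma odd_inv (hp5 : 5 ≤ p) : PP p 0 ((4:ℚ)⁻¹) := by
  have := PP.inv_unit (p := p) 4 (fun h => by have := Nat.le_of_dvd (by norm_num) h; omega)
  exact_mod_cast this

lemma sum_e (hp5 : 5 ≤ p) (s m : ℕ) (hm : p^(s+1) = 2*m+1) :
    PP p (-3) (∑ i ∈ Finset.range m, ((p:ℚ)^(s+1))^2 * (4⁻¹ * ((((i+1:ℕ):ℚ)^2)⁻¹))) := by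
  have p0 := (p_pos p).ne'
  have e0 : ∑ i ∈ Finset.range m, ((p:ℚ)^(s+1))^2 * (4⁻¹ * ((((i+1:ℕ):ℚ)^2)⁻¹)) =
      ∑ i ∈ Finset.Icc 1 m, ((p:ℚ)^(s+1))^2 * (4⁻¹ * (((i:ℚ)^2)⁻¹)) := by
    have e1 : Finset.Icc 1 m = Finset.Ico 1 (m+1) := by ext; simp only [Finset.mem_Icc, Finset.mem_Ico]; omega
    rw [e1, Finset.sum_Ico_eq_sum_range]
    simp [add_comm]
  rw [e0, ← Finset.sum_filter_add_sum_filter_not _ (fun i => p^s ∣ i)]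
  apply PP.add
  · have hps : 0 < p^s := pow_pos hp.out.pos s
    have hodd : p % 2 = 1 := by
      rcases hp.out.eq_two_or_odd with h | h <;> omega
    have e2 : (Finset.Icc 1 m).filter (fun i => p^s ∣ i) =
        (Finset.Icc 1 ((p-1)/2)).image (fun k => p^s * k) := by
      obtain ⟨g, hg⟩ : ∃ g, p = 2*g+1 := ⟨p/2, by omega⟩
      have hg2 : (p-1)/2 = g := by omega
      rw [hg2]
      ext i
      simp only [Finset.mem_filter, Finset.mem_Icc, Finset.mem_image]
      have hm2 : p^s * (2*g+1) = 2*m+1 := by rw [← hm, pow_succ, ← hg]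
      constructor
      · rintro ⟨⟨h1, h2⟩, k, rfl⟩
        refine ⟨k, ⟨?_, ?_⟩, rfl⟩
        · rcases k with _ | k
          · simp at h1
          · omega
        · by_contra hc
          have : p^s * (g+1) ≤ p^s * k := Nat.mul_le_mul_left _ (by omega)
          nlinarith
      · rintro ⟨k, ⟨h1, h2⟩, rfl⟩
        refine ⟨⟨?_, ?_⟩, dvd_mul_right _ _⟩
        · nlinarith
        · have : p^s * k ≤ p^s * g := Nat.mul_le_mul_left _ h2
          nlinarith
    rw [e2, Finset.sum_image (by
      intro a _ b _ hab
      exact Nat.eq_of_mul_eq_mul_left hps hab)]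
    have e3 : ∑ k ∈ Finset.Icc 1 ((p-1)/2), ((p:ℚ)^(s+1))^2 * (4⁻¹ * ((((p^s*k:ℕ):ℚ)^2)⁻¹)) =
        (p:ℚ)^2 * 4⁻¹ * ∑ k ∈ Finset.Icc 1 ((p-1)/2), ((k:ℚ)^2)⁻¹ := by
      rw [Finset.mul_sum]
      refine Finset.sum_congr rfl fun k hk => ?_
      simp at hk
      have k0 : (k:ℚ) ≠ 0 := by
        have : k ≠ 0 := by omega
        exact_mod_cast this
      push_cast
      field_simp
      ring
    rw [e3]
    exact (((PP.ppow 2).mul (odd_inv hp5)).mul (harm hp5)).congr (by norm_num) rfl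
  · apply PP.sum
    intro i hi
    simp only [Finset.mem_filter, Finset.mem_Icc] at hi
    obtain ⟨hi1, hi2⟩ := hi
    rcases s with _ | t
    · simp at hi2
    · have h1 := PP.inv_nat i t (by omega) hi2
      have h2 := (PP.ppow (p := p) (t+1+1)).mul h1
      have h3 := (h2.mul h2).mul (odd_inv hp5)
      refine PP.mono (h3.congr rfl ?_) ?_
      · rw [← inv_pow]
        ring
      · push_cast; omega
end padic

lemma poch_add (x : ℚ) (n j : ℕ) : poch x (n+j) = poch x n * poch (x+n) j := by
  induction j with
  | zero => simp [poch]
  | succ j ih => rw [← add_assoc, poch_succ, ih, poch_succ]; push_cast; ring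

lemma aa_central (n : ℕ) : aa n = (n.centralBinom : ℚ) * ((4:ℚ)⁻¹)^n := by
  induction n with
  | zero => simp [aa, poch]
  | succ n ih =>
    have h1 := aa_succ n
    have h2 : ((n:ℚ)+1) * (n+1).centralBinom = 2*(2*n+1) * n.centralBinom := by
      exact_mod_cast Nat.succ_mul_centralBinom_succ n
    have d : (2:ℚ)*(n+1) ≠ 0 := by positivity
    apply mul_right_cancel₀ d
    rw [h1, ih, pow_succ]
    linear_combination -(1/2) * ((4:ℚ)⁻¹)^n * h2

lemma poch_neg_desc (N j : ℕ) (h : j ≤ N) :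
    poch (-(N:ℚ)) j = (-1)^j * (N.descFactorial j : ℚ) := by
  induction j with
  | zero => simp [poch]
  | succ j ih =>
    rw [poch_succ, ih (by omega), Nat.descFactorial_succ, Nat.cast_mul, Nat.cast_sub (by omega)]
    ring

lemma shift_eq (n j : ℕ) :
    aa n * (poch (n+1/2) j / poch 1 j) = aa (n+j) * ((n+j).choose j : ℚ) := by
  have h1 : ((n+j).choose j : ℚ) * poch 1 n * poch 1 j = poch 1 (n+j) := by
    rw [poch_one, poch_one, poch_one]
    have := Nat.add_choose_mul_factorial_mul_factorial n j
    exact_mod_cast this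
  unfold aa
  rw [poch_add (1/2), add_comm (1/2:ℚ) (n:ℚ), ← h1]
  have d1 := poch_one_ne n
  have d2 := poch_one_ne j
  have d3 : ((n+j).choose j : ℚ) ≠ 0 := by
    exact_mod_cast (Nat.choose_pos (by omega)).ne'
  field_simp

lemma DD_half (m n j : ℕ) (hn : n = 2*m+1) : DD ((m+1/2)^2) j = poch 1 j^2 *
    ∏ i ∈ Finset.range j, (1 - (n:ℚ)^2 * (4⁻¹ * ((((i+1:ℕ):ℚ)^2)⁻¹))) := by
  unfold DD poch
  rw [← Finset.prod_pow, ← Finset.prod_mul_distrib]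
  refine Finset.prod_congr rfl fun i _ => ?_
  have : (i:ℚ)+1 ≠ 0 := by positivity
  rw [hn]; push_cast
  field_simp
  ring

lemma term_eq (m n j : ℕ) (hn : n = 2*m+1) (Q : ℚ)
    (hQ : Q = ∏ i ∈ Finset.range j, (1 - (n:ℚ)^2 * (4⁻¹ * ((((i+1:ℕ):ℚ)^2)⁻¹)))) :
    4*(n:ℚ)^2 * aa n^2 * (uu 0 n j - uu ((m+1/2)^2) n j) =
      4 * aa n * (aa n * (poch (n+1/2) j / poch 1 j)) * aa j * (poch (1-n) j / poch 1 j)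
        * Q⁻¹ * ((n:ℚ)^2 * ((2*j+1 : ℕ):ℚ)⁻¹ * (Q-1)) := by
  have h1 := DD_half m n j hn
  rw [← hQ] at h1
  have h2 : DD 0 j = poch 1 j^2 := by
    unfold DD poch; rw [← Finset.prod_pow]
    exact Finset.prod_congr rfl fun i _ => by ring
  have h3 := DD_ne _ j (hz_half m)
  rw [h1] at h3
  have hQ0 : Q ≠ 0 := right_ne_zero_of_mul h3
  have d1 := poch_one_ne j
  have d2 : (2:ℚ)*j+1 ≠ 0 := by positivity
  have h4 : aa j = poch (1/2) j / poch 1 j := rfl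
  unfold uu
  rw [h1, h2, h4]
  push_cast
  generalize poch (1/2) j = A at *
  generalize poch ((n:ℚ)+1/2) j = B at *
  generalize poch (1-(n:ℚ)) j = C at *
  generalize poch 1 j = P at *
  field_simp

lemma PP_aa {p : ℕ} [hp : Fact p.Prime] (hp5 : 5 ≤ p) (n : ℕ) : PP p 0 (aa n) := by
  rw [aa_central]
  have : PP p 0 (((4:ℚ)⁻¹)^n) := by
    induction n with
    | zero => simpa using PP.nat (p := p) 1
    | succ n ih => rw [pow_succ]; exact ih.mul (odd_inv hp5)
  exact (PP.nat _).mul this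

lemma PP_neg {p : ℕ} [hp : Fact p.Prime] (n j : ℕ) (h : j < n) :
    PP p 0 (poch (1-(n:ℚ)) j / poch 1 j) := by
  obtain ⟨N, rfl⟩ : ∃ N, n = N+1 := ⟨n-1, by omega⟩
  rw [show 1-((N+1:ℕ):ℚ) = -(N:ℚ) by push_cast; ring, poch_neg_desc N j (by omega),
    Nat.descFactorial_eq_factorial_mul_choose, poch_one]
  have d : (j.factorial:ℚ) ≠ 0 := by exact_mod_cast j.factorial_ne_zero
  refine ((PP.neg_one_pow (p := p) j).mul (PP.nat (N.choose j))).congr rfl ?_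
  push_cast
  field_simp

lemma core {p : ℕ} [hp : Fact p.Prime] (hp5 : 5 ≤ p) (s m n j : ℕ) (hn : n = 2*m+1)
    (hps : n = p^(s+1)) (hj : j < n) (Q : ℚ)
    (hQ : Q = ∏ i ∈ Finset.range j, (1 - (n:ℚ)^2 * (4⁻¹ * ((((i+1:ℕ):ℚ)^2)⁻¹)))) :
    PP p 0 Q⁻¹ ∧ PP p (-(s+4)) ((n:ℚ)^2 * ((2*j+1 : ℕ):ℚ)⁻¹ * (Q-1)) := by
  have hnp : PP p (-((s+1:ℕ):ℤ)) (n:ℚ) := by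
    rw [hps]; push_cast; exact_mod_cast PP.ppow (s+1)
  have he : ∀ i < j, PP p (-2) ((n:ℚ)^2 * (4⁻¹ * ((((i+1:ℕ):ℚ)^2)⁻¹))) := by
    intro i hi
    have h1 := PP.inv_nat (p := p) (i+1) s (by omega) (by
      intro hd
      have := Nat.le_of_dvd (by omega) hd
      omega)
    have h2 := hnp.mul h1
    refine ((h2.mul h2).mul (odd_inv hp5)).congr ?_ ?_
    · push_cast; ring
    · rw [← inv_pow]; ring
  obtain ⟨b1, b2⟩ := prod_bound (-2) (by norm_num) _ j he
  rw [← hQ] at b1 b2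
  refine ⟨inv_bound Q (b1.mono (by norm_num)), ?_⟩
  have hsq := hnp.mul hnp
  rw [← sq] at hsq
  by_cases hjm : j = m
  · subst hjm
    have b3 := sum_e hp5 s j (by omega)
    have e : (p:ℚ)^(s+1) = n := by rw [hps]; push_cast; rfl
    rw [e] at b3
    have b4 : PP p (-3) (Q-1) := ((b2.mono (by norm_num)).add b3.neg).congr rfl (by ring)
    have n0 : (n:ℚ) ≠ 0 := by
      have : n ≠ 0 := by omega
      exact_mod_cast this
    refine (hnp.mul b4).congr (by push_cast; ring) ?_
    rw [← hn]
    field_simp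
  · have hd : ¬ p^(s+1) ∣ 2*j+1 := by
      rw [← hps]
      rintro ⟨k, hk⟩
      have : k < 2 := by
        by_contra hc
        have : n*2 ≤ n*k := Nat.mul_le_mul_left _ (by omega)
        omega
      interval_cases k <;> omega
    have b3 := PP.inv_nat (p := p) (2*j+1) s (by omega) hd
    exact ((hsq.mul b3).mul b1).congr (by push_cast; ring) rfl

theorem stmt2 (p : ℕ) (hp : p.Prime) (hp5 : 5 ≤ p) (r : ℕ) (hr : 1 ≤ r) :
    ratCongr p ((r : ℤ) + 3)
      (∑ k ∈ Finset.range (p ^ r),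
        (4 * (k : ℚ) + 1) * poch (1/2) k ^ 4 / poch 1 k ^ 4)
      ((p : ℚ) ^ r) := by
  have : Fact p.Prime := ⟨hp⟩
  obtain ⟨s, rfl⟩ : ∃ s, r = s+1 := ⟨r-1, by omega⟩
  obtain ⟨n, hn⟩ : ∃ n, n = p^(s+1) := ⟨_, rfl⟩
  have hodd : Odd n := by
    rw [hn]
    exact (hp.odd_of_ne_two (by omega)).pow
  obtain ⟨m, hm⟩ := hodd
  apply ratCongr_of_PP
  have e : (p:ℚ)^(s+1) = n := by rw [hn]; push_cast; rfl
  rw [e, ← hn, key m n hm]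
  apply PP.sum
  intro j hj
  rw [Finset.mem_range] at hj
  obtain ⟨c1, c2⟩ := core hp5 s m n j hm hn hj _ rfl
  rw [term_eq m n j hm _ rfl]
  have t1 : PP p 0 (4:ℚ) := by exact_mod_cast PP.nat (p := p) 4
  have t2 : PP p 0 (aa n * (poch (n+1/2) j / poch 1 j)) := by
    rw [shift_eq]
    exact (PP_aa hp5 _).mul (PP.nat _)
  exact (((((((t1.mul (PP_aa hp5 n)).mul t2).mul (PP_aa hp5 j)).mul (PP_neg n j hj)).mul c1)).mul
    c2).congr (by push_cast; ring) rfl
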